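/- Let u be a nonnegative smooth solution of the heat equation Δu = ∂_t u on ℝⁿ × (-∞, 0]. Then u is nondecreasing in time: ∂_t u(x,t) ≥ 0 for all x ∈ ℝⁿ and t ≤ 0. -/

import Mathlib

open MeasureTheory Real

noncomputable section

/-- Spatial Laplacian of `f : ℝⁿ → ℝ` at `x` (sum of second partial derivatives). -/
def lap (n : ℕ) (f : EuclideanSpace ℝ (Fin n) → ℝ) (x : EuclideanSpace ℝ (Fin n)) : ℝ :=
  ∑ i : Fin n, fderiv ℝ (fun y => fderiv ℝ f y (EuclideanSpace.single i 1)) x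
    (EuclideanSpace.single i 1)

/-- `u` is a smooth ancient solution of the heat equation on `ℝⁿ × (-∞, 0]`:
it is smooth and satisfies `Δ_x u = ∂_t u` for all `t ≤ 0`. -/
def IsAncientHeat (n : ℕ) (u : EuclideanSpace ℝ (Fin n) × ℝ → ℝ) : Prop :=
  ContDiff ℝ (⊤ : ℕ∞) u ∧ ∀ (x : EuclideanSpace ℝ (Fin n)) (t : ℝ), t ≤ 0 →
    lap n (fun y => u (y, t)) x = deriv (fun s => u (x, s)) t

open Set Filter Topology
open scoped ContDiff

section DirectionalDerivative

variable {V : Type*} [NormedAddCommGroup V] [NormedSpace ℝ V]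

/-- The derivative of `g` at `p` in the direction `v`. -/
def dirDeriv (v : V) (g : V → ℝ) (p : V) : ℝ := fderiv ℝ g p v

variable {O : Set V} {g h : V → ℝ} {p : V}

lemma ContDiffOn.differentiableAt_of_isOpen (hO : IsOpen O) (hg : ContDiffOn ℝ ∞ g O)
    (hp : p ∈ O) : DifferentiableAt ℝ g p :=
  (hg.contDiffAt (hO.mem_nhds hp)).differentiableAt (by simp)

lemma ContDiffOn.dirDeriv (hO : IsOpen O) (hg : ContDiffOn ℝ ∞ g O) (v : V) :
    ContDiffOn ℝ ∞ (dirDeriv v g) O :=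
  (hg.fderiv_of_isOpen hO (m := ∞) (by simp)).clm_apply contDiffOn_const

lemma dirDeriv_congr (hO : IsOpen O) (hgh : EqOn g h O) (v : V) (hp : p ∈ O) :
    dirDeriv v g p = dirDeriv v h p := by
  have : g =ᶠ[𝓝 p] h := hgh.eventuallyEq_of_mem (hO.mem_nhds hp)
  rw [dirDeriv, this.fderiv_eq, dirDeriv]

lemma dirDeriv_comm (hO : IsOpen O) (hg : ContDiffOn ℝ ∞ g O) (v w : V) (hp : p ∈ O) :
    dirDeriv v (dirDeriv w g) p = dirDeriv w (dirDeriv v g) p := by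
  have hd : DifferentiableAt ℝ (fderiv ℝ g) p :=
    ((hg.fderiv_of_isOpen hO (m := ∞) (by simp)).contDiffAt
      (hO.mem_nhds hp)).differentiableAt (by simp)
  have key : ∀ a b : V, dirDeriv a (dirDeriv b g) p = fderiv ℝ (fderiv ℝ g) p a b := by
    intro a b
    have := hd.hasFDerivAt.clm_apply (hasFDerivAt_const b p)
    change fderiv ℝ (fun q => fderiv ℝ g q b) p a = _
    rw [this.fderiv]
    simp
  rw [key, key]
  have hs : IsSymmSndFDerivAt ℝ g p :=
    (hg.contDiffAt (hO.mem_nhds hp)).isSymmSndFDerivAt (by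
      simp only [minSmoothness_of_isRCLikeNormedField]
      exact WithTop.coe_le_coe.2 le_top)
  exact hs v w

lemma dirDeriv_add (hg : DifferentiableAt ℝ g p) (hh : DifferentiableAt ℝ h p) (v : V) :
    dirDeriv v (fun q => g q + h q) p = dirDeriv v g p + dirDeriv v h p := by
  simp [dirDeriv, fderiv_fun_add hg hh]

lemma dirDeriv_sub (hg : DifferentiableAt ℝ g p) (hh : DifferentiableAt ℝ h p) (v : V) :
    dirDeriv v (fun q => g q - h q) p = dirDeriv v g p - dirDeriv v h p := by
  simp [dirDeriv, fderiv_fun_sub hg hh]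

lemma dirDeriv_mul (hg : DifferentiableAt ℝ g p) (hh : DifferentiableAt ℝ h p) (v : V) :
    dirDeriv v (fun q => g q * h q) p = g p * dirDeriv v h p + h p * dirDeriv v g p := by
  simp [dirDeriv, fderiv_fun_mul hg hh]

lemma dirDeriv_const_mul (hg : DifferentiableAt ℝ g p) (c : ℝ) (v : V) :
    dirDeriv v (fun q => c * g q) p = c * dirDeriv v g p := by
  simp [dirDeriv, fderiv_const_mul hg c]

lemma dirDeriv_sum {ι : Type*} [Fintype ι] {g : ι → V → ℝ}
    (hg : ∀ i, DifferentiableAt ℝ (g i) p) (v : V) :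
    dirDeriv v (fun q => ∑ i, g i q) p = ∑ i, dirDeriv v (g i) p := by
  simp [dirDeriv, fderiv_fun_sum (u := Finset.univ) fun i _ => hg i]

lemma dirDeriv_comp {φ : ℝ → ℝ} {φ' : ℝ} (hφ : HasDerivAt φ φ' (g p))
    (hg : DifferentiableAt ℝ g p) (v : V) :
    dirDeriv v (fun q => φ (g q)) p = φ' * dirDeriv v g p := by
  have := hφ.comp_hasFDerivAt p hg.hasFDerivAt
  change fderiv ℝ (φ ∘ g) p v = _
  rw [this.fderiv]
  simp [dirDeriv]

lemma hasDerivAt_comp_line (hg : DifferentiableAt ℝ g p) (v : V) :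
    HasDerivAt (fun s : ℝ => g (p + s • v)) (dirDeriv v g p) 0 := by
  have h1 : HasDerivAt (fun s : ℝ => p + s • v) v 0 := by
    simpa using ((hasDerivAt_id (0 : ℝ)).smul_const v).const_add p
  have h2 : HasFDerivAt g (fderiv ℝ g p) (p + (0 : ℝ) • v) := by
    simpa using hg.hasFDerivAt
  exact h2.comp_hasDerivAt (0 : ℝ) h1

lemma IsLocalMax.deriv_deriv_nonpos {φ : ℝ → ℝ} {a : ℝ} (hm : IsLocalMax φ a)
    (hc : ContinuousAt φ a) : deriv (deriv φ) a ≤ 0 := by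
  by_contra! hpos
  have hmin := isLocalMin_of_deriv_deriv_pos hpos hm.deriv_eq_zero hc
  have hconst : φ =ᶠ[𝓝 a] fun _ => φ a := by
    filter_upwards [hm, hmin] with s h1 h2 using le_antisymm h1 h2
  have := hconst.deriv.deriv_eq
  simp at this
  linarith

end DirectionalDerivative

section Bochner

variable {V : Type*} [NormedAddCommGroup V] [NormedSpace ℝ V] {ι : Type*} [Fintype ι]

/-- The Li–Yau quantity `|∇f|² - 2 ∂_t f`, for spatial directions `e` and time direction `τ`. -/
def liYau (e : ι → V) (τ : V) (f : V → ℝ) (p : V) : ℝ :=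
  ∑ i, dirDeriv (e i) f p * dirDeriv (e i) f p - 2 * dirDeriv τ f p

variable {O : Set V} {f : V → ℝ} {p : V}

lemma ContDiffOn.liYau (hO : IsOpen O) (hf : ContDiffOn ℝ ∞ f O) (e : ι → V) (τ : V) :
    ContDiffOn ℝ ∞ (liYau e τ f) O :=
  (ContDiffOn.sum fun i _ => (hf.dirDeriv hO (e i)).mul (hf.dirDeriv hO (e i))).sub
    (contDiffOn_const.mul (hf.dirDeriv hO τ))

lemma dirDeriv_sum_mul_self (hO : IsOpen O) (hf : ContDiffOn ℝ ∞ f O) (e : ι → V) (w : V)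
    (hp : p ∈ O) :
    dirDeriv w (fun q => ∑ i, dirDeriv (e i) f q * dirDeriv (e i) f q) p =
      ∑ i, 2 * (dirDeriv (e i) f p * dirDeriv w (dirDeriv (e i) f) p) := by
  have hd : ∀ i, DifferentiableAt ℝ (dirDeriv (e i) f) p := fun i =>
    (hf.dirDeriv hO (e i)).differentiableAt_of_isOpen hO hp
  rw [dirDeriv_sum fun i => (hd i).fun_mul (hd i)]
  refine Finset.sum_congr rfl fun i _ => ?_
  rw [dirDeriv_mul (hd i) (hd i)]
  ring

lemma dirDeriv_liYau (hO : IsOpen O) (hf : ContDiffOn ℝ ∞ f O) (e : ι → V) (τ w : V)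
    (hp : p ∈ O) :
    dirDeriv w (liYau e τ f) p =
      ∑ i, 2 * (dirDeriv (e i) f p * dirDeriv w (dirDeriv (e i) f) p) -
        2 * dirDeriv w (dirDeriv τ f) p := by
  have hd : ∀ v, DifferentiableAt ℝ (dirDeriv v f) p := fun v =>
    (hf.dirDeriv hO v).differentiableAt_of_isOpen hO hp
  have h := dirDeriv_sub (DifferentiableAt.fun_sum (u := Finset.univ)
    fun i _ => (hd (e i)).fun_mul (hd (e i))) ((hd τ).const_mul 2) w
  rw [dirDeriv_sum_mul_self hO hf e w hp, dirDeriv_const_mul (hd τ)] at h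
  exact h

/-- Bochner's identity: if `∂_t f = Δf + |∇f|²`, then `P = |∇f|² - 2 ∂_t f` satisfies
`∂_t P - ΔP - 2 ∇f · ∇P = -2 |∇²f|²`. -/
lemma liYau_evolution (hO : IsOpen O) (hf : ContDiffOn ℝ ∞ f O) (e : ι → V) (τ : V)
    (heq : EqOn (dirDeriv τ f) (fun q => ∑ j, dirDeriv (e j) (dirDeriv (e j) f) q +
      ∑ i, dirDeriv (e i) f q * dirDeriv (e i) f q) O) (hp : p ∈ O) :
    dirDeriv τ (liYau e τ f) p - ∑ j, dirDeriv (e j) (dirDeriv (e j) (liYau e τ f)) p -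
      2 * ∑ j, dirDeriv (e j) f p * dirDeriv (e j) (liYau e τ f) p =
      -2 * ∑ j, ∑ i, dirDeriv (e j) (dirDeriv (e i) f) p ^ 2 := by
  have hD : ∀ v, ContDiffOn ℝ ∞ (dirDeriv v f) O := fun v => hf.dirDeriv hO v
  have hd : ∀ v, DifferentiableAt ℝ (dirDeriv v f) p := fun v =>
    (hD v).differentiableAt_of_isOpen hO hp
  have hd2 : ∀ v w, DifferentiableAt ℝ (dirDeriv w (dirDeriv v f)) p := fun v w =>
    ((hD v).dirDeriv hO w).differentiableAt_of_isOpen hO hp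
  have hcomm : ∀ v w u, dirDeriv u (dirDeriv v (dirDeriv w f)) p =
      dirDeriv u (dirDeriv w (dirDeriv v f)) p := fun v w u =>
    dirDeriv_congr hO (fun q hq => dirDeriv_comm hO hf v w hq) u hp
  have hlap : ∀ j w, dirDeriv (e j) (dirDeriv (e j) (dirDeriv w f)) p =
      dirDeriv w (dirDeriv (e j) (dirDeriv (e j) f)) p := fun j w => by
    rw [hcomm, dirDeriv_comm hO (hD (e j)) (e j) w hp]
  have hevol : ∀ w, dirDeriv τ (dirDeriv w f) p =
      ∑ j, dirDeriv w (dirDeriv (e j) (dirDeriv (e j) f)) p +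
        ∑ i, 2 * (dirDeriv (e i) f p * dirDeriv w (dirDeriv (e i) f) p) := fun w => by
    rw [dirDeriv_comm hO hf τ w hp, dirDeriv_congr hO heq w hp,
      dirDeriv_add (DifferentiableAt.fun_sum fun j _ => hd2 (e j) (e j))
        (DifferentiableAt.fun_sum fun j _ => (hd (e j)).fun_mul (hd (e j))),
      dirDeriv_sum fun j => hd2 (e j) (e j), dirDeriv_sum_mul_self hO hf e w hp]
  have hsecond : ∀ j, dirDeriv (e j) (dirDeriv (e j) (liYau e τ f)) p =
      ∑ i, 2 * (dirDeriv (e j) (dirDeriv (e i) f) p ^ 2 +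
        dirDeriv (e i) f p * dirDeriv (e i) (dirDeriv (e j) (dirDeriv (e j) f)) p) -
      2 * dirDeriv τ (dirDeriv (e j) (dirDeriv (e j) f)) p := fun j => by
    rw [dirDeriv_congr hO (fun q hq => dirDeriv_liYau hO hf e τ (e j) hq) (e j) hp,
      dirDeriv_sub (DifferentiableAt.fun_sum fun i _ =>
          ((hd (e i)).fun_mul (hd2 (e i) (e j))).const_mul 2) ((hd2 τ (e j)).const_mul 2),
      dirDeriv_sum fun i => ((hd (e i)).fun_mul (hd2 (e i) (e j))).const_mul 2,
      dirDeriv_const_mul (hd2 τ (e j)), hlap j τ]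
    congr 1
    refine Finset.sum_congr rfl fun i _ => ?_
    rw [dirDeriv_const_mul ((hd (e i)).fun_mul (hd2 (e i) (e j))),
      dirDeriv_mul (hd (e i)) (hd2 (e i) (e j)), hlap j (e i)]
    ring
  have hfirst : ∀ j, dirDeriv (e j) (liYau e τ f) p =
      dirDeriv τ (dirDeriv (e j) f) p -
        ∑ i, dirDeriv (e j) (dirDeriv (e i) (dirDeriv (e i) f)) p -
        2 * dirDeriv τ (dirDeriv (e j) f) p := fun j => by
    rw [dirDeriv_liYau hO hf e τ (e j) hp, dirDeriv_comm hO hf (e j) τ hp, hevol (e j)]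
    ring
  have hsum : ∑ j, dirDeriv (e j) (dirDeriv (e j) (liYau e τ f)) p =
      2 * ∑ j, ∑ i, dirDeriv (e j) (dirDeriv (e i) f) p ^ 2 +
      2 * ∑ i, dirDeriv (e i) f p *
        ∑ j, dirDeriv (e i) (dirDeriv (e j) (dirDeriv (e j) f)) p -
      2 * ∑ j, dirDeriv τ (dirDeriv (e j) (dirDeriv (e j) f)) p := by
    simp_rw [hsecond, mul_add, Finset.sum_sub_distrib, Finset.sum_add_distrib, Finset.mul_sum]
    rw [Finset.sum_comm (f := fun j i => 2 * (dirDeriv (e i) f p *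
      dirDeriv (e i) (dirDeriv (e j) (dirDeriv (e j) f)) p))]
  rw [hsum, dirDeriv_liYau hO hf e τ τ hp, hevol τ]
  simp_rw [hfirst, mul_sub, Finset.sum_sub_distrib, ← Finset.mul_sum,
    mul_left_comm _ (2 : ℝ), ← Finset.mul_sum]
  ring

end Bochner

section MaximumPrinciple

variable {V : Type*} [NormedAddCommGroup V] [NormedSpace ℝ V] {O : Set V} {g : V → ℝ} {p : V}

lemma dirDeriv_dirDeriv_nonpos_of_isLocalMax_line (hO : IsOpen O) (hg : ContDiffOn ℝ ∞ g O)
    (hp : p ∈ O) {v : V} (hm : IsLocalMax (fun s : ℝ => g (p + s • v)) 0) :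
    dirDeriv v g p = 0 ∧ dirDeriv v (dirDeriv v g) p ≤ 0 := by
  have hline := hasDerivAt_comp_line (hg.differentiableAt_of_isOpen hO hp) v
  refine ⟨by rw [← hline.deriv, hm.deriv_eq_zero], ?_⟩
  have hcont : ContinuousAt (fun s : ℝ => p + s • v) 0 := by fun_prop
  have hmem : ∀ᶠ s : ℝ in 𝓝 0, p + s • v ∈ O :=
    hcont.eventually_mem (by simpa using hO.mem_nhds hp)
  have hderiv : deriv (fun s : ℝ => g (p + s • v)) =ᶠ[𝓝 0]
      fun s => dirDeriv v g (p + s • v) := by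
    filter_upwards [hmem] with s hs
    have h := hasDerivAt_comp_line (hg.differentiableAt_of_isOpen hO hs) v
    rw [← sub_self s] at h
    have h2 := h.comp_sub_const s s
    simp only [add_assoc, ← add_smul, add_sub_cancel] at h2
    exact h2.deriv
  have h2 := hm.deriv_deriv_nonpos hline.continuousAt
  rwa [hderiv.deriv_eq, (hasDerivAt_comp_line
    ((hg.dirDeriv hO v).differentiableAt_of_isOpen hO hp) v).deriv] at h2

lemma dirDeriv_nonneg_of_le_left (hg : DifferentiableAt ℝ g p) {v : V}
    (hm : ∀ᶠ s : ℝ in 𝓝[<] 0, g (p + s • v) ≤ g p) : 0 ≤ dirDeriv v g p := by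
  have hline := (hasDerivAt_comp_line hg v).hasDerivWithinAt (s := Iio 0)
  rw [hasDerivWithinAt_iff_tendsto_slope' (by simp)] at hline
  refine ge_of_tendsto hline ?_
  filter_upwards [hm, self_mem_nhdsWithin] with s hs hs0
  rw [slope_def_field]
  refine div_nonneg_of_nonpos ?_ ?_
  · simpa using hs
  · simpa using hs0.le

end MaximumPrinciple

section Barrier

variable {n : ℕ}

/-- The `i`-th spatial unit direction in space-time. -/
def spaceDir (i : Fin n) : EuclideanSpace ℝ (Fin n) × ℝ := (EuclideanSpace.single i 1, 0)

/-- The unit time direction in space-time. -/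
def timeDir (n : ℕ) : EuclideanSpace ℝ (Fin n) × ℝ := (0, 1)

/-- The function `R² - |x - x₀|²` on space-time. -/
def bump (x₀ : EuclideanSpace ℝ (Fin n)) (R : ℝ) (p : EuclideanSpace ℝ (Fin n) × ℝ) : ℝ :=
  R ^ 2 - ‖p.1 - x₀‖ ^ 2

/-- A supersolution blowing up at the parabolic boundary of `B(x₀, R) × (t₀, ∞)`. -/
def barrier (x₀ : EuclideanSpace ℝ (Fin n)) (R t₀ c : ℝ)
    (p : EuclideanSpace ℝ (Fin n) × ℝ) : ℝ :=
  2 * n * (p.2 - t₀)⁻¹ + c * (bump x₀ R p ^ 2)⁻¹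

variable {x₀ : EuclideanSpace ℝ (Fin n)} {R t₀ c : ℝ} {p : EuclideanSpace ℝ (Fin n) × ℝ}

lemma contDiff_bump : ContDiff ℝ ∞ (bump x₀ R) :=
  contDiff_const.sub ((contDiff_fst.sub contDiff_const).norm_sq ℝ)

lemma differentiableAt_bump : DifferentiableAt ℝ (bump x₀ R) p :=
  contDiff_bump.contDiffAt.differentiableAt (by simp)

lemma dirDeriv_bump (v : EuclideanSpace ℝ (Fin n) × ℝ) :
    dirDeriv v (bump x₀ R) p = -2 * inner ℝ (p.1 - x₀) v.1 := by
  have h := ((hasFDerivAt_fst (𝕜 := ℝ) (p := p)).sub_const x₀).norm_sq.const_sub (R ^ 2)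
  change fderiv ℝ (fun q : EuclideanSpace ℝ (Fin n) × ℝ => R ^ 2 - ‖q.1 - x₀‖ ^ 2) p v = _
  rw [h.fderiv]
  simp [inner_sub_left]

lemma dirDeriv_spaceDir_bump (i : Fin n) :
    dirDeriv (spaceDir i) (bump x₀ R) p = -2 * (p.1 - x₀) i := by
  simp [dirDeriv_bump, spaceDir, EuclideanSpace.inner_single_right]

lemma dirDeriv_timeDir_bump : dirDeriv (timeDir n) (bump x₀ R) p = 0 := by
  simp [dirDeriv_bump, timeDir]

lemma dirDeriv_time (v : EuclideanSpace ℝ (Fin n) × ℝ) :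
    dirDeriv v (fun q : EuclideanSpace ℝ (Fin n) × ℝ => q.2 - t₀) p = v.2 := by
  have h := (hasFDerivAt_snd (𝕜 := ℝ) (p := p)).sub_const t₀
  rw [dirDeriv, h.fderiv]
  simp

lemma dirDeriv_coord (i : Fin n) (v : EuclideanSpace ℝ (Fin n) × ℝ) :
    dirDeriv v (fun q : EuclideanSpace ℝ (Fin n) × ℝ => (q.1 - x₀) i) p = v.1 i := by
  have h := ((EuclideanSpace.proj (𝕜 := ℝ) i).hasFDerivAt.comp p
    ((hasFDerivAt_fst (𝕜 := ℝ) (p := p)).sub_const x₀))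
  change fderiv ℝ (EuclideanSpace.proj i ∘ fun q : EuclideanSpace ℝ (Fin n) × ℝ => q.1 - x₀) p v
    = _
  rw [h.fderiv]
  simp

/-- The cylinder `B(x₀, R) × (t₀, ∞)`. -/
def barrierDomain (x₀ : EuclideanSpace ℝ (Fin n)) (R t₀ : ℝ) :
    Set (EuclideanSpace ℝ (Fin n) × ℝ) :=
  {p | 0 < bump x₀ R p ∧ t₀ < p.2}

lemma isOpen_barrierDomain : IsOpen (barrierDomain x₀ R t₀) :=
  (isOpen_lt continuous_const contDiff_bump.continuous).inter
    (isOpen_lt continuous_const continuous_snd)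

lemma contDiffOn_barrier : ContDiffOn ℝ ∞ (barrier x₀ R t₀ c) (barrierDomain x₀ R t₀) := by
  refine (contDiffOn_const.mul ((contDiffOn_snd.sub contDiffOn_const).inv fun q hq => ?_)).add
    (contDiffOn_const.mul ((contDiff_bump.contDiffOn.pow 2).inv fun q hq => ?_))
  · exact (sub_pos.2 hq.2).ne'
  · exact (pow_pos hq.1 2).ne'

lemma dirDeriv_barrier (hp : p ∈ barrierDomain x₀ R t₀) (v : EuclideanSpace ℝ (Fin n) × ℝ) :
    dirDeriv v (barrier x₀ R t₀ c) p =
      -(2 * n * ((p.2 - t₀) ^ 2)⁻¹ * v.2) -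
        2 * c * (bump x₀ R p ^ 3)⁻¹ * dirDeriv v (bump x₀ R) p := by
  have hs : p.2 - t₀ ≠ 0 := (sub_pos.2 hp.2).ne'
  have hb : bump x₀ R p ≠ 0 := hp.1.ne'
  have hds : DifferentiableAt ℝ (fun q : EuclideanSpace ℝ (Fin n) × ℝ => q.2 - t₀) p := by
    fun_prop
  have h1 := (hasDerivAt_inv hs).const_mul (2 * n : ℝ)
  have h2 := ((hasDerivAt_pow 2 (bump x₀ R p)).inv (pow_ne_zero 2 hb)).const_mul c
  have h := dirDeriv_add (h1.differentiableAt.comp p hds)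
    (h2.differentiableAt.comp p differentiableAt_bump) v
  have e1 := dirDeriv_comp (g := fun q : EuclideanSpace ℝ (Fin n) × ℝ => q.2 - t₀) h1 hds v
  have e2 := dirDeriv_comp h2 differentiableAt_bump v
  rw [dirDeriv_time] at e1
  refine (h.trans (congrArg₂ _ e1 e2)).trans ?_
  field_simp
  ring

lemma dirDeriv_spaceDir_barrier (hp : p ∈ barrierDomain x₀ R t₀) (i : Fin n) :
    dirDeriv (spaceDir i) (barrier x₀ R t₀ c) p =
      4 * c * ((p.1 - x₀) i * (bump x₀ R p ^ 3)⁻¹) := by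
  rw [dirDeriv_barrier hp, dirDeriv_spaceDir_bump]
  simp only [spaceDir]
  ring

lemma dirDeriv_timeDir_barrier (hp : p ∈ barrierDomain x₀ R t₀) :
    dirDeriv (timeDir n) (barrier x₀ R t₀ c) p = -(2 * n * ((p.2 - t₀) ^ 2)⁻¹) := by
  rw [dirDeriv_barrier hp, dirDeriv_timeDir_bump]
  simp [timeDir]

lemma dirDeriv_dirDeriv_spaceDir_barrier (hp : p ∈ barrierDomain x₀ R t₀) (i : Fin n) :
    dirDeriv (spaceDir i) (dirDeriv (spaceDir i) (barrier x₀ R t₀ c)) p =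
      4 * c * ((bump x₀ R p ^ 3)⁻¹ + 6 * (p.1 - x₀) i ^ 2 * (bump x₀ R p ^ 4)⁻¹) := by
  have hb : bump x₀ R p ≠ 0 := hp.1.ne'
  have hd : DifferentiableAt ℝ
      (fun q : EuclideanSpace ℝ (Fin n) × ℝ => (q.1 - x₀) i) p :=
    (EuclideanSpace.proj (𝕜 := ℝ) i).differentiableAt.comp p
      (differentiableAt_fst.sub_const x₀)
  have h := (hasDerivAt_pow 3 (bump x₀ R p)).inv (pow_ne_zero 3 hb)
  have hdb : DifferentiableAt ℝ (fun q => (bump x₀ R q ^ 3)⁻¹) p :=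
    h.differentiableAt.comp p differentiableAt_bump
  have e := dirDeriv_comp h differentiableAt_bump (spaceDir i)
  rw [dirDeriv_congr isOpen_barrierDomain (fun q hq => dirDeriv_spaceDir_barrier hq i) _ hp,
    dirDeriv_const_mul (hd.fun_mul hdb), dirDeriv_mul hd hdb, dirDeriv_coord]
  refine (congrArg (fun z => 4 * c * ((p.1 - x₀) i * z + _)) e).trans ?_
  rw [dirDeriv_spaceDir_bump]
  simp only [spaceDir, PiLp.single_apply, if_true]
  field_simp
  ring

end Barrier

section LocalEstimate

variable {n : ℕ}

lemma barrier_cross_term_le {N q s r R : ℝ} (hN : 0 < N) (hq : 0 < q) (hs : 0 < s)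
    (hr : 0 ≤ r) (hR : q + r = R ^ 2) {x y : Fin n → ℝ} (hx : ∑ i, x i ^ 2 = r) :
    2 * ∑ i, y i * (4 * (2 * N * (20 * N + 24) * R ^ 2) * (x i * (q ^ 3)⁻¹)) ≤
      -(2 * N * (s ^ 2)⁻¹) -
        4 * (2 * N * (20 * N + 24) * R ^ 2) * (N * (q ^ 3)⁻¹ + 6 * r * (q ^ 4)⁻¹) +
      (2 * N * s⁻¹ + 2 * N * (20 * N + 24) * R ^ 2 * (q ^ 2)⁻¹ + ∑ i, y i * y i) ^ 2 /
        (2 * N) := by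
  set c := 2 * N * (20 * N + 24) * R ^ 2 with hc
  set G := ∑ i, y i * y i with hG
  have hR2 : 0 < R ^ 2 := by linarith
  have hc0 : 0 < c := by positivity
  have hG0 : 0 ≤ G := Finset.sum_nonneg fun i _ => mul_self_nonneg _
  have hxy : ∑ i, 2 * (x i * y i) ≤ 4 * N / q * r + q / (4 * N) * G := by
    rw [← hx, hG, Finset.mul_sum, Finset.mul_sum, ← Finset.sum_add_distrib]
    refine Finset.sum_le_sum fun i _ => ?_
    have : 4 * N / q * x i ^ 2 + q / (4 * N) * (y i * y i) - 2 * (x i * y i) =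
        (4 * N * x i - q * y i) ^ 2 / (4 * N * q) := by
      field_simp
      ring
    have : 0 ≤ (4 * N * x i - q * y i) ^ 2 / (4 * N * q) := by positivity
    linarith
  have hleft : 2 * ∑ i, y i * (4 * c * (x i * (q ^ 3)⁻¹)) =
      4 * c * (q ^ 3)⁻¹ * ∑ i, 2 * (x i * y i) := by
    rw [Finset.mul_sum, Finset.mul_sum]
    exact Finset.sum_congr rfl fun i _ => by ring
  have hstep : 2 * ∑ i, y i * (4 * c * (x i * (q ^ 3)⁻¹)) ≤
      4 * c * (q ^ 3)⁻¹ * (4 * N / q * r + q / (4 * N) * G) :=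
    hleft.trans_le (mul_le_mul_of_nonneg_left hxy (by positivity))
  refine hstep.trans ?_
  have key : -(2 * N * (s ^ 2)⁻¹) - 4 * c * (N * (q ^ 3)⁻¹ + 6 * r * (q ^ 4)⁻¹) +
      (2 * N * s⁻¹ + c * (q ^ 2)⁻¹ + G) ^ 2 / (2 * N) -
      4 * c * (q ^ 3)⁻¹ * (4 * N / q * r + q / (4 * N) * G) =
      c * (q ^ 4)⁻¹ * (c / (2 * N) - 16 * N * r - 4 * N * q - 24 * r) +
        (G ^ 2 + 4 * N * s⁻¹ * (c * (q ^ 2)⁻¹) + 4 * N * s⁻¹ * G) / (2 * N) := by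
    field_simp
    ring
  have hcN : c / (2 * N) = (20 * N + 24) * (q + r) := by
    rw [hc, hR]
    field_simp
  have h1 : 0 ≤ c / (2 * N) - 16 * N * r - 4 * N * q - 24 * r := by
    rw [hcN]
    nlinarith [mul_pos hN hq, mul_nonneg hN.le hr]
  have h2 : 0 ≤ c * (q ^ 4)⁻¹ * (c / (2 * N) - 16 * N * r - 4 * N * q - 24 * r) := by
    positivity
  have h3 : 0 ≤ (G ^ 2 + 4 * N * s⁻¹ * (c * (q ^ 2)⁻¹) + 4 * N * s⁻¹ * G) / (2 * N) := by
    positivity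
  linarith

/-- The set of strictly negative times in space-time. -/
def pastDomain (n : ℕ) : Set (EuclideanSpace ℝ (Fin n) × ℝ) := {p | p.2 < 0}

lemma isOpen_pastDomain : IsOpen (pastDomain n) := isOpen_lt continuous_snd continuous_const

variable {f : EuclideanSpace ℝ (Fin n) × ℝ → ℝ} {x₀ : EuclideanSpace ℝ (Fin n)} {R t₀ t₁ : ℝ}
  {p : EuclideanSpace ℝ (Fin n) × ℝ}

/-- `P - B` has no parabolic interior maximum at which it is positive, where `P` is the Li–Yau
quantity and `B` is the barrier. -/
lemma liYau_le_barrier_of_isMax (hn : 0 < n) (hf : ContDiffOn ℝ ∞ f (pastDomain n))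
    (heq : EqOn (dirDeriv (timeDir n) f)
      (fun q => ∑ j, dirDeriv (spaceDir j) (dirDeriv (spaceDir j) f) q +
        ∑ i, dirDeriv (spaceDir i) f q * dirDeriv (spaceDir i) f q) (pastDomain n))
    (hp : p ∈ pastDomain n) (hpB : p ∈ barrierDomain x₀ R t₀)
    (hmax : ∀ q ∈ barrierDomain x₀ R t₀, q.2 ≤ p.2 →
      liYau spaceDir (timeDir n) f q -
          barrier x₀ R t₀ (2 * n * (20 * n + 24) * R ^ 2) q ≤
        liYau spaceDir (timeDir n) f p -
          barrier x₀ R t₀ (2 * n * (20 * n + 24) * R ^ 2) p) :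
    liYau spaceDir (timeDir n) f p ≤ barrier x₀ R t₀ (2 * n * (20 * n + 24) * R ^ 2) p := by
  set c : ℝ := 2 * n * (20 * n + 24) * R ^ 2 with hc
  set P := liYau spaceDir (timeDir n) f with hP
  set B := barrier x₀ R t₀ c with hB
  by_contra! hlt
  have hO := isOpen_pastDomain (n := n)
  have hU := isOpen_barrierDomain (n := n) (x₀ := x₀) (R := R) (t₀ := t₀)
  have hW := hO.inter hU
  have hPs : ContDiffOn ℝ ∞ P (pastDomain n) := hf.liYau hO spaceDir (timeDir n)
  have hBs : ContDiffOn ℝ ∞ B (barrierDomain x₀ R t₀) := contDiffOn_barrier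
  have hGs : ContDiffOn ℝ ∞ (fun q => P q - B q) (pastDomain n ∩ barrierDomain x₀ R t₀) :=
    (hPs.mono inter_subset_left).sub (hBs.mono inter_subset_right)
  have hG : ∀ q ∈ pastDomain n ∩ barrierDomain x₀ R t₀, ∀ v,
      dirDeriv v (fun q => P q - B q) q = dirDeriv v P q - dirDeriv v B q := fun q hq v =>
    dirDeriv_sub (hPs.differentiableAt_of_isOpen hO hq.1)
      (hBs.differentiableAt_of_isOpen hU hq.2) v
  have hGG : ∀ v, dirDeriv v (dirDeriv v (fun q => P q - B q)) p =
      dirDeriv v (dirDeriv v P) p - dirDeriv v (dirDeriv v B) p := fun v => by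
    rw [dirDeriv_congr hW (fun q hq => hG q hq v) v ⟨hp, hpB⟩,
      dirDeriv_sub ((hPs.dirDeriv hO v).differentiableAt_of_isOpen hO hp)
        ((hBs.dirDeriv hU v).differentiableAt_of_isOpen hU hpB)]
  have hline : ∀ v : EuclideanSpace ℝ (Fin n) × ℝ,
      ∀ᶠ s : ℝ in 𝓝 0, p + s • v ∈ barrierDomain x₀ R t₀ := fun v => by
    have hcont : ContinuousAt (fun s : ℝ => p + s • v) 0 := by fun_prop
    exact hcont.eventually_mem (by simpa using hU.mem_nhds hpB)
  have hspace : ∀ i, dirDeriv (spaceDir i) P p = dirDeriv (spaceDir i) B p ∧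
      dirDeriv (spaceDir i) (dirDeriv (spaceDir i) P) p ≤
        dirDeriv (spaceDir i) (dirDeriv (spaceDir i) B) p := fun i => by
    have hm : IsLocalMax (fun s : ℝ => P (p + s • spaceDir i) - B (p + s • spaceDir i)) 0 := by
      filter_upwards [hline (spaceDir i)] with s hs
      simpa using hmax _ hs (by simp [spaceDir])
    have h := dirDeriv_dirDeriv_nonpos_of_isLocalMax_line hW hGs ⟨hp, hpB⟩ hm
    rw [hG p ⟨hp, hpB⟩, hGG] at h
    exact ⟨by linarith, by linarith⟩
  have htime : dirDeriv (timeDir n) B p ≤ dirDeriv (timeDir n) P p := by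
    have hm : ∀ᶠ s : ℝ in 𝓝[<] 0,
        (fun q => P q - B q) (p + s • timeDir n) ≤ (fun q => P q - B q) p := by
      filter_upwards [nhdsWithin_le_nhds (hline (timeDir n)), self_mem_nhdsWithin] with s hs hs0
      refine hmax _ hs ?_
      have : s < 0 := hs0
      simp [timeDir, this.le]
    have h := dirDeriv_nonneg_of_le_left (hGs.differentiableAt_of_isOpen hW ⟨hp, hpB⟩) hm
    rw [hG p ⟨hp, hpB⟩] at h
    linarith
  have hn' : (0 : ℝ) < n := Nat.cast_pos.2 hn
  have hev := liYau_evolution hO hf spaceDir (timeDir n) heq hp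
  rw [← hP] at hev
  have hlap : (∑ j, dirDeriv (spaceDir j) (dirDeriv (spaceDir j) f) p) ^ 2 ≤
      n * ∑ j : Fin n, ∑ i, dirDeriv (spaceDir j) (dirDeriv (spaceDir i) f) p ^ 2 := by
    have h := sq_sum_le_card_mul_sum_sq (s := Finset.univ)
      (f := fun j : Fin n => dirDeriv (spaceDir j) (dirDeriv (spaceDir j) f) p)
    rw [Finset.card_univ, Fintype.card_fin] at h
    refine h.trans (mul_le_mul_of_nonneg_left (Finset.sum_le_sum fun j _ => ?_) hn'.le)
    exact Finset.single_le_sum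
      (f := fun i => dirDeriv (spaceDir j) (dirDeriv (spaceDir i) f) p ^ 2)
      (fun i _ => sq_nonneg _) (Finset.mem_univ j)
  have hPdef : P p = ∑ i, dirDeriv (spaceDir i) f p * dirDeriv (spaceDir i) f p -
      2 * dirDeriv (timeDir n) f p := rfl
  have hBdef : B p = 2 * n * (p.2 - t₀)⁻¹ + c * (bump x₀ R p ^ 2)⁻¹ := rfl
  have heqp := heq hp
  simp only at heqp
  have hx : ∑ i, (p.1 - x₀) i ^ 2 = ‖p.1 - x₀‖ ^ 2 :=
    (EuclideanSpace.real_norm_sq_eq (p.1 - x₀)).symm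
  have hcross := barrier_cross_term_le hn' hpB.1 (sub_pos.2 hpB.2) (sq_nonneg ‖p.1 - x₀‖)
    (sub_add_cancel (R ^ 2) (‖p.1 - x₀‖ ^ 2)) (y := fun i => dirDeriv (spaceDir i) f p) hx
  rw [← hc, ← hBdef] at hcross
  have hgrad : ∑ j, dirDeriv (spaceDir j) f p * dirDeriv (spaceDir j) P p =
      ∑ i, dirDeriv (spaceDir i) f p * (4 * c * ((p.1 - x₀) i * (bump x₀ R p ^ 3)⁻¹)) :=
    Finset.sum_congr rfl fun i _ => by
      rw [(hspace i).1, hB, dirDeriv_spaceDir_barrier hpB]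
  have hlapP : ∑ j, dirDeriv (spaceDir j) (dirDeriv (spaceDir j) P) p ≤
      4 * c * (n * (bump x₀ R p ^ 3)⁻¹ + 6 * ‖p.1 - x₀‖ ^ 2 * (bump x₀ R p ^ 4)⁻¹) := by
    refine (Finset.sum_le_sum fun i _ => (hspace i).2).trans_eq ?_
    simp_rw [hB, dirDeriv_dirDeriv_spaceDir_barrier hpB]
    rw [← hx, ← Finset.mul_sum, Finset.sum_add_distrib, ← Finset.sum_mul, ← Finset.mul_sum]
    simp
  rw [hB, dirDeriv_timeDir_barrier hpB] at htime
  rw [hgrad] at hev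
  set g := ∑ i, dirDeriv (spaceDir i) f p * dirDeriv (spaceDir i) f p
  set H := ∑ j : Fin n, ∑ i, dirDeriv (spaceDir j) (dirDeriv (spaceDir i) f) p ^ 2
  set L := ∑ j, dirDeriv (spaceDir j) (dirDeriv (spaceDir j) f) p
  have hg0 : 0 ≤ g := Finset.sum_nonneg fun i _ => mul_self_nonneg _
  have hB0 : 0 < B p := by
    have h1 := hpB.1
    have h2 := sub_pos.2 hpB.2
    rw [hBdef]
    positivity
  have hL : L = -(P p + g) / 2 := by linarith
  have hH : (P p + g) ^ 2 / (2 * n) ≤ 2 * H := by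
    rw [div_le_iff₀ (by positivity)]
    rw [hL] at hlap
    linarith
  have hstrict : (B p + g) ^ 2 / (2 * n) < (P p + g) ^ 2 / (2 * n) := by
    gcongr
  linarith

/-- The local Li–Yau gradient estimate. -/
lemma liYau_le_barrier (hn : 0 < n) (hf : ContDiffOn ℝ ∞ f (pastDomain n))
    (heq : EqOn (dirDeriv (timeDir n) f)
      (fun q => ∑ j, dirDeriv (spaceDir j) (dirDeriv (spaceDir j) f) q +
        ∑ i, dirDeriv (spaceDir i) f q * dirDeriv (spaceDir i) f q) (pastDomain n))
    (hR : 0 < R) (h01 : t₀ < t₁) (ht₁ : t₁ < 0) :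
    liYau spaceDir (timeDir n) f (x₀, t₁) ≤
      barrier x₀ R t₀ (2 * n * (20 * n + 24) * R ^ 2) (x₀, t₁) := by
  set c : ℝ := 2 * n * (20 * n + 24) * R ^ 2 with hc
  set P := liYau spaceDir (timeDir n) f with hP
  set B := barrier x₀ R t₀ c with hB
  by_contra! hlt
  have hn' : (0 : ℝ) < n := Nat.cast_pos.2 hn
  have hc0 : 0 < c := by positivity
  have hPs : ContDiffOn ℝ ∞ P (pastDomain n) :=
    hf.liYau isOpen_pastDomain spaceDir (timeDir n)
  set K := Metric.closedBall x₀ R ×ˢ Icc t₀ t₁ with hK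
  have hKc : IsCompact K := (isCompact_closedBall x₀ R).prod isCompact_Icc
  have hKO : K ⊆ pastDomain n := fun q hq => hq.2.2.trans_lt ht₁
  have hUK : ∀ q ∈ barrierDomain x₀ R t₀, q.2 ≤ t₁ → q ∈ K := fun q hq hqt => by
    refine ⟨?_, hq.2.le, hqt⟩
    rw [Metric.mem_closedBall, dist_eq_norm]
    have h : 0 < R ^ 2 - ‖q.1 - x₀‖ ^ 2 := hq.1
    exact abs_le_of_sq_le_sq' (by linarith) hR.le |>.2
  have h0U : (x₀, t₁) ∈ barrierDomain x₀ R t₀ := ⟨by simp [bump, hR], h01⟩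
  obtain ⟨M, hM⟩ := hKc.bddAbove_image (hPs.continuousOn.mono hKO)
  have hPM : ∀ q ∈ K, P q ≤ M := fun q hq => hM (mem_image_of_mem _ hq)
  have hpos : ∀ q ∈ barrierDomain x₀ R t₀,
      0 < 2 * n * (q.2 - t₀)⁻¹ ∧ 0 < c * (bump x₀ R q ^ 2)⁻¹ := fun q hq => by
    have h1 := hq.1
    have h2 := sub_pos.2 hq.2
    constructor <;> positivity
  set C := K ∩ {q | 2 * n ≤ M * (q.2 - t₀) ∧ c ≤ M * bump x₀ R q ^ 2} with hC
  have hCc : IsCompact C := by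
    have h1 : IsClosed {q : EuclideanSpace ℝ (Fin n) × ℝ | 2 * n ≤ M * (q.2 - t₀)} :=
      isClosed_le continuous_const (by fun_prop)
    have h2 : IsClosed {q : EuclideanSpace ℝ (Fin n) × ℝ | c ≤ M * bump x₀ R q ^ 2} :=
      isClosed_le continuous_const (continuous_const.mul (contDiff_bump.continuous.pow 2))
    exact hKc.inter_right (h1.inter h2)
  have hmemC : ∀ q ∈ barrierDomain x₀ R t₀, q.2 ≤ t₁ → B q ≤ M → q ∈ C := fun q hq hqt hqM => by
    have h1 := hq.1
    have h2 := sub_pos.2 hq.2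
    obtain ⟨h3, h4⟩ := hpos q hq
    have h5 : 2 * n * (q.2 - t₀)⁻¹ + c * (bump x₀ R q ^ 2)⁻¹ ≤ M := hqM
    refine ⟨hUK q hq hqt, ?_, ?_⟩
    · rw [← div_le_iff₀ h2, div_eq_mul_inv]
      linarith
    · rw [← div_le_iff₀ (by positivity), div_eq_mul_inv]
      linarith
  have hCU : C ⊆ barrierDomain x₀ R t₀ := fun q hq => by
    obtain ⟨⟨hq1, hq2⟩, hq3, hq4⟩ := hq
    rw [Metric.mem_closedBall, dist_eq_norm] at hq1
    refine ⟨lt_of_le_of_ne ?_ ?_, lt_of_le_of_ne hq2.1 ?_⟩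
    · exact sub_nonneg.2 (pow_le_pow_left₀ (norm_nonneg _) hq1 2)
    · intro h
      rw [← h] at hq4
      norm_num at hq4
      linarith
    · intro h
      rw [h] at hq3
      norm_num at hq3
      linarith
  have h0C : (x₀, t₁) ∈ C := hmemC _ h0U le_rfl (hlt.le.trans (hPM _ (hUK _ h0U le_rfl)))
  obtain ⟨p, hpC, hp⟩ := hCc.exists_isMaxOn ⟨_, h0C⟩
    (((hPs.continuousOn.mono hKO).mono inter_subset_left).sub
      ((contDiffOn_barrier (c := c)).continuousOn.mono hCU))
  have hp0 : P (x₀, t₁) - B (x₀, t₁) ≤ P p - B p := hp h0C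
  have hle := liYau_le_barrier_of_isMax hn hf heq (hKO hpC.1) (hCU hpC) fun q hq hqt => by
    change P q - B q ≤ P p - B p
    have hqt₁ : q.2 ≤ t₁ := hqt.trans hpC.1.2.2
    by_cases hqM : B q ≤ M
    · exact hp (hmemC q hq hqt₁ hqM)
    · have := hPM q (hUK q hq hqt₁)
      linarith
  change P p ≤ B p at hle
  linarith

end LocalEstimate

section HeatEquation

variable {n : ℕ} {u : EuclideanSpace ℝ (Fin n) × ℝ → ℝ}

lemma fderiv_slice_space {g : EuclideanSpace ℝ (Fin n) × ℝ → ℝ}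
    {x : EuclideanSpace ℝ (Fin n)} {t : ℝ} (hg : DifferentiableAt ℝ g (x, t)) (i : Fin n) :
    fderiv ℝ (fun y => g (y, t)) x (EuclideanSpace.single i 1) =
      dirDeriv (spaceDir i) g (x, t) := by
  have h := hg.hasFDerivAt.comp x (hasFDerivAt_prodMk_left (𝕜 := ℝ) x t)
  change fderiv ℝ (g ∘ fun y => (y, t)) x _ = _
  rw [h.fderiv]
  simp [dirDeriv, spaceDir]

lemma deriv_slice_time {g : EuclideanSpace ℝ (Fin n) × ℝ → ℝ}
    {x : EuclideanSpace ℝ (Fin n)} {t : ℝ} (hg : DifferentiableAt ℝ g (x, t)) :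
    deriv (fun s => g (x, s)) t = dirDeriv (timeDir n) g (x, t) := by
  have h := hg.hasFDerivAt.comp_hasDerivAt t (hasFDerivAt_prodMk_right (𝕜 := ℝ) x t).hasDerivAt
  change deriv (g ∘ fun s => (x, s)) t = _
  rw [h.deriv]
  simp [dirDeriv, timeDir]

lemma lap_slice (hu : ContDiff ℝ ∞ u) (x : EuclideanSpace ℝ (Fin n)) (t : ℝ) :
    lap n (fun y => u (y, t)) x =
      ∑ i, dirDeriv (spaceDir i) (dirDeriv (spaceDir i) u) (x, t) := by
  refine Finset.sum_congr rfl fun i _ => ?_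
  have h : (fun y => fderiv ℝ (fun y => u (y, t)) y (EuclideanSpace.single i 1)) =
      fun y => dirDeriv (spaceDir i) u (y, t) := funext fun y =>
    fderiv_slice_space (hu.contDiffAt.differentiableAt (by simp)) i
  rw [h]
  exact fderiv_slice_space ((hu.contDiffOn.dirDeriv isOpen_univ
    (spaceDir i)).differentiableAt_of_isOpen isOpen_univ (mem_univ _)) i

section Log

variable {V : Type*} [NormedAddCommGroup V] [NormedSpace ℝ V] {O : Set V} {v : V → ℝ} {p : V}

lemma dirDeriv_log (hO : IsOpen O) (hv : ContDiffOn ℝ ∞ v O) (hpos : ∀ q ∈ O, 0 < v q)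
    (w : V) (hp : p ∈ O) :
    dirDeriv w (fun q => log (v q)) p = (v p)⁻¹ * dirDeriv w v p :=
  dirDeriv_comp (hasDerivAt_log (hpos p hp).ne') (hv.differentiableAt_of_isOpen hO hp) w

lemma dirDeriv_dirDeriv_log (hO : IsOpen O) (hv : ContDiffOn ℝ ∞ v O)
    (hpos : ∀ q ∈ O, 0 < v q) (w : V) (hp : p ∈ O) :
    dirDeriv w (dirDeriv w (fun q => log (v q))) p =
      (v p)⁻¹ * dirDeriv w (dirDeriv w v) p -
        dirDeriv w (fun q => log (v q)) p * dirDeriv w (fun q => log (v q)) p := by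
  have hvp := (hpos p hp).ne'
  have hd := hv.differentiableAt_of_isOpen hO hp
  rw [dirDeriv_log hO hv hpos w hp,
    dirDeriv_congr hO (fun q hq => dirDeriv_log hO hv hpos w hq) w hp,
    dirDeriv_mul (hd.fun_inv hvp) ((hv.dirDeriv hO w).differentiableAt_of_isOpen hO hp),
    dirDeriv_comp (hasDerivAt_inv hvp) hd]
  field_simp
  ring

end Log

/-- The Li–Yau quantity of the logarithm of a positive ancient solution is nonpositive. -/
lemma liYau_log_nonpos {v : EuclideanSpace ℝ (Fin n) × ℝ → ℝ} (hn : 0 < n)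
    (hv : ContDiffOn ℝ ∞ v (pastDomain n)) (hpos : ∀ q ∈ pastDomain n, 0 < v q)
    (heat : ∀ q ∈ pastDomain n,
      dirDeriv (timeDir n) v q = ∑ i, dirDeriv (spaceDir i) (dirDeriv (spaceDir i) v) q)
    {x : EuclideanSpace ℝ (Fin n)} {t : ℝ} (ht : t < 0) :
    liYau spaceDir (timeDir n) (fun q => log (v q)) (x, t) ≤ 0 := by
  have hO := isOpen_pastDomain (n := n)
  have hf : ContDiffOn ℝ ∞ (fun q => log (v q)) (pastDomain n) :=
    hv.log fun q hq => (hpos q hq).ne'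
  have heq : EqOn (dirDeriv (timeDir n) (fun q => log (v q)))
      (fun q => ∑ j, dirDeriv (spaceDir j) (dirDeriv (spaceDir j) (fun q => log (v q))) q +
        ∑ i, dirDeriv (spaceDir i) (fun q => log (v q)) q *
          dirDeriv (spaceDir i) (fun q => log (v q)) q) (pastDomain n) := fun q hq => by
    simp_rw [dirDeriv_dirDeriv_log hO hv hpos _ hq]
    rw [dirDeriv_log hO hv hpos _ hq, heat q hq, Finset.mul_sum, ← Finset.sum_add_distrib]
    simp
  have hbound : ∀ s : ℝ, 0 < s → liYau spaceDir (timeDir n) (fun q => log (v q)) (x, t) ≤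
      (2 * n + 2 * n * (20 * n + 24)) * s⁻¹ := fun s hs => by
    refine (liYau_le_barrier (R := √s) (t₀ := t - s) (x₀ := x) hn hf heq (sqrt_pos.2 hs)
      (sub_lt_self t hs) ht).trans_eq ?_
    simp only [barrier, bump, sub_self, norm_zero, sq_sqrt hs.le, sub_sub_cancel, ne_eq, OfNat.ofNat_ne_zero,
      not_false_eq_true, zero_pow, sub_zero]
    field_simp
  refine ge_of_tendsto (x := atTop) ?_ (eventually_atTop.2 ⟨1, fun s hs =>
    hbound s (zero_lt_one.trans_le hs)⟩)
  simpa using tendsto_inv_atTop_zero.const_mul (2 * n + 2 * n * (20 * n + 24) : ℝ)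

lemma IsAncientHeat.dirDeriv_timeDir_nonneg (hn : 0 < n) (hu : IsAncientHeat n u)
    (hnonneg : ∀ (x : EuclideanSpace ℝ (Fin n)) (t : ℝ), t ≤ 0 → 0 ≤ u (x, t))
    {x : EuclideanSpace ℝ (Fin n)} {t : ℝ} (ht : t < 0) :
    0 ≤ dirDeriv (timeDir n) u (x, t) := by
  have hO := isOpen_pastDomain (n := n)
  have hus : ContDiff ℝ ∞ u := hu.1
  have hdiff : ∀ q, DifferentiableAt ℝ u q := fun q =>
    hus.contDiffAt.differentiableAt (by simp)
  have hadd : ∀ w, dirDeriv w (fun q => u q + 1) = dirDeriv w u := fun w => funext fun q => by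
    simp [dirDeriv]
  have hv : ContDiffOn ℝ ∞ (fun q => u q + 1) (pastDomain n) :=
    hus.contDiffOn.add contDiffOn_const
  have hpos : ∀ q ∈ pastDomain n, 0 < u q + 1 := fun q hq => by
    have h := hnonneg q.1 q.2 (le_of_lt hq)
    change 0 ≤ u q at h
    linarith
  have h := liYau_log_nonpos hn hv hpos (fun q hq => by
    simp_rw [hadd]
    exact (deriv_slice_time (hdiff q)).symm.trans
      ((hu.2 q.1 q.2 (le_of_lt hq)).symm.trans (lap_slice hus q.1 q.2))) (x := x) ht
  rw [liYau, dirDeriv_log hO hv hpos (timeDir n) ht, hadd] at h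
  have hg : 0 ≤ ∑ i, dirDeriv (spaceDir i) (fun q => log (u q + 1)) (x, t) *
      dirDeriv (spaceDir i) (fun q => log (u q + 1)) (x, t) :=
    Finset.sum_nonneg fun i _ => mul_self_nonneg _
  have hinv : 0 < (u (x, t) + 1)⁻¹ := inv_pos.2 (hpos (x, t) ht)
  exact nonneg_of_mul_nonneg_right (by linarith) hinv

end HeatEquation

/-- a nonnegative ancient solution of the heat equation on
`ℝⁿ × (-∞, 0]` is nondecreasing in time: `∂_t u(x,t) ≥ 0` for `t ≤ 0`. -/
theorem ancient_nonneg_heat_time_monotone (n : ℕ)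
    (u : EuclideanSpace ℝ (Fin n) × ℝ → ℝ)
    (hu : IsAncientHeat n u)
    (hnonneg : ∀ (x : EuclideanSpace ℝ (Fin n)) (t : ℝ), t ≤ 0 → 0 ≤ u (x, t)) :
    ∀ (x : EuclideanSpace ℝ (Fin n)) (t : ℝ), t ≤ 0 →
      0 ≤ deriv (fun s => u (x, s)) t := by
  intro x t ht
  rcases n.eq_zero_or_pos with rfl | hn
  · rw [← hu.2 x t ht]
    simp [lap]
  have hus : ContDiff ℝ ∞ u := hu.1
  rw [deriv_slice_time (hus.contDiffAt.differentiableAt (by simp))]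
  have hcont : Continuous fun s : ℝ => dirDeriv (timeDir n) u (x, s) :=
    (continuousOn_univ.1
      (hus.contDiffOn.dirDeriv isOpen_univ (timeDir n)).continuousOn).comp (by fun_prop)
  have hclosed : IsClosed {s : ℝ | 0 ≤ dirDeriv (timeDir n) u (x, s)} :=
    isClosed_le continuous_const hcont
  have hsub : Iio (0 : ℝ) ⊆ {s : ℝ | 0 ≤ dirDeriv (timeDir n) u (x, s)} := fun s hs =>
    hu.dirDeriv_timeDir_nonneg hn hnonneg hs
  exact closure_minimal hsub hclosed (by simpa using ht)
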